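/- If a commutative semigroup variety V with V ≠ COM is an upper-modular element of the lattice Com, then every subvariety of V is an upper-modular element of the lattice Com. -/

import Mathlib

/-!
Formalization framework: semigroup varieties as Galois-closed equational theories
over the free semigroup on countably many letters.  A variety is represented by
its equational theory; the order `V ≤ W` ("V is a subvariety of W") is reverse
inclusion of theories.  `Com` is the lattice of commutative semigroup varieties,
realized as the subtype of varieties whose theory contains the commutative law.
-/

open FreeSemigroup

/-- Words: elements of the free semigroup over a countably infinite alphabet. -/
abbrev Word : Type := FreeSemigroup ℕ

/-- A semigroup identity `u = v`. -/
abbrev SgId : Type := Word × Word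

/-- `spow a n = a ^ (n + 1)` in any (multiplicative) semigroup. -/
def spow {M : Type*} [Mul M] (a : M) : ℕ → M
  | 0 => a
  | n + 1 => a * spow a n

/-- A semigroup `S` satisfies the identity `e.1 = e.2`. -/
def SatS (S : Type) [Semigroup S] (e : SgId) : Prop :=
  ∀ σ : ℕ → S, FreeSemigroup.lift σ e.1 = FreeSemigroup.lift σ e.2

/-- `S` is a model of the set of identities `E`. -/
def Models (S : Type) [Semigroup S] (E : Set SgId) : Prop :=
  ∀ e ∈ E, SatS S e

/-- The equational theory generated by `E`: all identities holding in every
model of `E` (by Birkhoff's theorem this is exactly deductive closure). -/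
def eqTh (E : Set SgId) : Set SgId :=
  { e | ∀ (S : Type) [Semigroup S], Models S E → SatS S e }

theorem subset_eqTh (E : Set SgId) : E ⊆ eqTh E := by
  intro e he S _ hS
  exact hS e he

theorem eqTh_mono {E F : Set SgId} (h : E ⊆ F) : eqTh E ⊆ eqTh F := by
  intro e he S _ hS
  exact he S fun e' he' => hS e' (h he')

theorem eqTh_idem (E : Set SgId) : eqTh (eqTh E) = eqTh E := by
  refine Set.Subset.antisymm ?_ (subset_eqTh _)
  intro e he S _ hS
  exact he S fun e' he' => he' S hS

/-- A semigroup variety, given by its (Galois-closed) equational theory. -/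
structure SgVariety where
  th : Set SgId
  closed : eqTh th = th

theorem SgVariety.ext' {V W : SgVariety} (h : V.th = W.th) : V = W := by
  cases V; cases W; cases h; rfl

/-- The variety defined by a set of identities. -/
def varOf (E : Set SgId) : SgVariety :=
  ⟨eqTh E, eqTh_idem E⟩

/-- `V ≤ W` iff `V` is a subvariety of `W`, i.e. the theory of `W` is contained
in the theory of `V`. -/
instance : PartialOrder SgVariety where
  le V W := W.th ⊆ V.th
  le_refl V := Set.Subset.refl _
  le_trans a b c h1 h2 := Set.Subset.trans h2 h1
  le_antisymm a b h1 h2 := SgVariety.ext' (Set.Subset.antisymm h2 h1)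

/-- The lattice **SEM** of all semigroup varieties: join is intersection of
theories; meet is the variety defined by the union of the theories. -/
instance : Lattice SgVariety :=
  { (inferInstance : PartialOrder SgVariety) with
    sup := fun V W =>
      ⟨V.th ∩ W.th, by
        refine Set.Subset.antisymm (Set.subset_inter ?_ ?_) (subset_eqTh _)
        · exact (eqTh_mono Set.inter_subset_left).trans (le_of_eq V.closed)
        · exact (eqTh_mono Set.inter_subset_right).trans (le_of_eq W.closed)⟩
    le_sup_left := fun V W => Set.inter_subset_left
    le_sup_right := fun V W => Set.inter_subset_right
    sup_le := fun V W U h1 h2 => Set.subset_inter h1 h2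
    inf := fun V W => varOf (V.th ∪ W.th)
    inf_le_left := fun V W => Set.subset_union_left.trans (subset_eqTh _)
    inf_le_right := fun V W => Set.subset_union_right.trans (subset_eqTh _)
    le_inf := fun U V W h1 h2 =>
      (eqTh_mono (Set.union_subset h1 h2)).trans (le_of_eq U.closed) }

/-- The letters `x`, `y`, `z`. -/
def xw : Word := FreeSemigroup.of 0
def yw : Word := FreeSemigroup.of 1
def zw : Word := FreeSemigroup.of 2

/-- The commutative law `xy = yx`. -/
def commId : SgId := (xw * yw, yw * xw)

/-- The lattice **Com**: commutative semigroup varieties. -/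
abbrev ComVariety : Type := { V : SgVariety // commId ∈ V.th }

instance : Lattice ComVariety :=
  { (inferInstance : PartialOrder ComVariety) with
    sup := fun V W => ⟨V.1 ⊔ W.1, ⟨V.2, W.2⟩⟩
    le_sup_left := fun V W => @le_sup_left SgVariety _ V.1 W.1
    le_sup_right := fun V W => @le_sup_right SgVariety _ V.1 W.1
    sup_le := fun V W U h1 h2 => @sup_le SgVariety _ V.1 W.1 U.1 h1 h2
    inf := fun V W => ⟨V.1 ⊓ W.1, subset_eqTh _ (Set.mem_union_left _ V.2)⟩
    inf_le_left := fun V W => @inf_le_left SgVariety _ V.1 W.1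
    inf_le_right := fun V W => @inf_le_right SgVariety _ V.1 W.1
    le_inf := fun U V W h1 h2 => @le_inf SgVariety _ U.1 V.1 W.1 h1 h2 }

/-- The trivial variety `T`. -/
def trivialVar : SgVariety := varOf Set.univ

/-- The variety `COM` of all commutative semigroups. -/
def COMvar : SgVariety := varOf {commId}

/-- The variety `SL` of semilattices. -/
def SLvar : SgVariety := varOf {commId, (xw * xw, xw)}

/-- `C_m = var{xᵐ = xᵐ⁺¹, xy = yx}` for `m ≥ 1`, and `C_0 = T`. -/
def Cvar : ℕ → SgVariety
  | 0 => trivialVar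
  | m + 1 => varOf {commId, (spow xw m, spow xw (m + 1))}

def Tcom : ComVariety := ⟨trivialVar, subset_eqTh _ (Set.mem_univ _)⟩
def COMcom : ComVariety := ⟨COMvar, subset_eqTh _ rfl⟩
def SLcom : ComVariety := ⟨SLvar, subset_eqTh _ (Set.mem_insert _ _)⟩
def Ccom (m : ℕ) : ComVariety :=
  ⟨Cvar m, by
    cases m with
    | zero => exact subset_eqTh _ (Set.mem_univ _)
    | succ m => exact subset_eqTh _ (Set.mem_insert _ _)⟩

/-- A semigroup (nonempty, with the given multiplication) is a group. -/
def IsGroupS (S : Type) [Semigroup S] : Prop :=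
  ∃ e : S, (∀ a : S, e * a = a ∧ a * e = a) ∧ ∀ a : S, ∃ b : S, a * b = e ∧ b * a = e

/-- A nilsemigroup: there is a zero element and some power of every element is zero. -/
def IsNilS (S : Type) [Semigroup S] : Prop :=
  ∃ z : S, (∀ a : S, z * a = z ∧ a * z = z) ∧ ∀ a : S, ∃ n : ℕ, spow a n = z

/-- A group variety: all its (nonempty) members are groups. -/
def IsGroupVariety (V : SgVariety) : Prop :=
  ∀ (S : Type) [Semigroup S], Nonempty S → Models S V.th → IsGroupS S

/-- A nil-variety: all its (nonempty) members are nilsemigroups. -/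
def IsNilVariety (V : SgVariety) : Prop :=
  ∀ (S : Type) [Semigroup S], Nonempty S → Models S V.th → IsNilS S

/-- A combinatorial variety: all groups in it are singletons. -/
def IsCombinatorial (V : SgVariety) : Prop :=
  ∀ (S : Type) [Semigroup S], Models S V.th → IsGroupS S → Subsingleton S

/-- A periodic variety: satisfies `xⁿ = xⁿ⁺ᵏ` for some `n, k ≥ 1`. -/
def IsPeriodic (V : SgVariety) : Prop :=
  ∃ n k : ℕ, (spow xw n, spow xw (n + k + 1)) ∈ V.th

/-- The letter `k` occurs in the word `w`. -/
def occursIn (k : ℕ) (w : Word) : Prop := k = w.head ∨ k ∈ w.tail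

/-- `S` satisfies the identity `w = 0` (i.e. the system `wx = xw = w`, `x` fresh):
every value of `w` in `S` is a (two-sided) zero element. -/
def SatZeroS (S : Type) [Semigroup S] (w : Word) : Prop :=
  ∀ (σ : ℕ → S) (a : S),
    FreeSemigroup.lift σ w * a = FreeSemigroup.lift σ w ∧
      a * FreeSemigroup.lift σ w = FreeSemigroup.lift σ w

/-- The variety `V` satisfies the identity `w = 0`. -/
def VSatZero (V : SgVariety) (w : Word) : Prop :=
  ∀ (S : Type) [Semigroup S], Models S V.th → SatZeroS S w

/-- The words `x²`, `x³`, `x²y`, `xy²`, `x²yz`. -/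
def w_xx : Word := xw * xw
def w_xxx : Word := xw * xw * xw
def w_xxy : Word := xw * xw * yw
def w_xyy : Word := xw * yw * yw
def w_xxyz : Word := xw * xw * yw * zw

/-- The identity `x²y = xy²`. -/
def idQ : SgId := (w_xxy, w_xyy)

/-- The pair of identities expressing `w = 0`, with `k` a fresh letter. -/
def zeroPair (w : Word) (k : ℕ) : Set SgId :=
  {(w * FreeSemigroup.of k, w), (FreeSemigroup.of k * w, w)}

/-- `xprodTo n = x₁x₂⋯xₙ` (for `n ≥ 1`), on the letters `0, …, n-1`. -/
def xprodTo : ℕ → Word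
  | 0 => FreeSemigroup.of 0
  | 1 => FreeSemigroup.of 0
  | n + 2 => xprodTo (n + 1) * FreeSemigroup.of (n + 1)

/-- `I = var{x²y = xy², x²yz = 0, xy = yx}`. -/
def Ivar : SgVariety := varOf ({commId, idQ} ∪ zeroPair w_xxyz 3)

/-- `K = var{x²y = 0, xy = yx}`. -/
def Kvar : SgVariety := varOf ({commId} ∪ zeroPair w_xxy 2)

/-- `L = var{x² = 0, xy = yx}`. -/
def Lvar : SgVariety := varOf ({commId} ∪ zeroPair w_xx 1)

/-- `I_n = var{x²yz = x₁⋯xₙ = 0, x²y = xy², xy = yx}`. -/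
def Ivarn (n : ℕ) : SgVariety :=
  varOf ({commId, idQ} ∪ zeroPair w_xxyz 3 ∪ zeroPair (xprodTo n) n)

/-- `J = var{x²yz = x³ = 0, x²y = xy², xy = yx}`. -/
def Jvar : SgVariety := varOf ({commId, idQ} ∪ zeroPair w_xxyz 3 ∪ zeroPair w_xxx 1)

/-- `J_n = var{x²yz = x³ = x₁⋯xₙ = 0, x²y = xy², xy = yx}`. -/
def Jvarn (n : ℕ) : SgVariety :=
  varOf ({commId, idQ} ∪ zeroPair w_xxyz 3 ∪ zeroPair w_xxx 1 ∪ zeroPair (xprodTo n) n)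

/-- `K_n = var{x²y = x₁⋯xₙ = 0, xy = yx}`. -/
def Kvarn (n : ℕ) : SgVariety :=
  varOf ({commId} ∪ zeroPair w_xxy 2 ∪ zeroPair (xprodTo n) n)

/-- `L_n = var{x² = x₁⋯xₙ = 0, xy = yx}`. -/
def Lvarn (n : ℕ) : SgVariety :=
  varOf ({commId} ∪ zeroPair w_xx 1 ∪ zeroPair (xprodTo n) n)

/-- Generators of `ZR(U)`: the commutative law together with all 0-reduced
identities (in the form of the corresponding identity pairs) holding in `U`. -/
def ZRgen (U : SgVariety) : Set SgId :=
  {commId} ∪ { e : SgId | ∃ (w : Word) (k : ℕ), ¬ occursIn k w ∧ VSatZero U w ∧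
      (e = (w * FreeSemigroup.of k, w) ∨ e = (FreeSemigroup.of k * w, w)) }

/-- `ZR(U)`: the variety given by the commutative law and all 0-reduced
identities holding in `U`. -/
def ZRvar (U : SgVariety) : SgVariety := varOf (ZRgen U)

def Icom : ComVariety := ⟨Ivar, subset_eqTh _ (Set.mem_union_left _ (Set.mem_insert _ _))⟩

def ZRcom (U : SgVariety) : ComVariety :=
  ⟨ZRvar U, subset_eqTh _ (Set.mem_union_left _ rfl)⟩

/-- All nilsemigroups in `V` are nilpotent of degree ≤ n, i.e. satisfy `x₁⋯xₙ = 0`. -/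
def HasDegLe (V : SgVariety) (n : ℕ) : Prop :=
  ∀ (S : Type) [Semigroup S], Nonempty S → Models S V.th → IsNilS S → SatZeroS S (xprodTo n)

/-- `deg V = d` (with `d = ⊤` meaning infinite degree). -/
def DegIs (V : SgVariety) (d : ℕ∞) : Prop :=
  (∃ n : ℕ, 0 < n ∧ d = (n : ℕ∞) ∧ IsLeast {m : ℕ | 0 < m ∧ HasDegLe V m} n) ∨
    (d = ⊤ ∧ ∀ n : ℕ, 0 < n → ¬ HasDegLe V n)

/-- Upper-modular element of a lattice. -/
def IsUpperModular {L : Type*} [Lattice L] (a : L) : Prop :=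
  ∀ b c : L, b ≤ a → a ⊓ (b ⊔ c) = b ⊔ (a ⊓ c)

/-- Codistributive element of a lattice. -/
def IsCodistributive {L : Type*} [Lattice L] (a : L) : Prop :=
  ∀ b c : L, a ⊓ (b ⊔ c) = (a ⊓ b) ⊔ (a ⊓ c)

/-- Costandard element of a lattice. -/
def IsCostandard {L : Type*} [Lattice L] (a : L) : Prop :=
  ∀ b c : L, (a ⊓ b) ⊔ c = (a ⊔ c) ⊓ (b ⊔ c)

/-- Modular element of a lattice. -/
def IsModularElt {L : Type*} [Lattice L] (a : L) : Prop :=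
  ∀ b c : L, b ≤ c → (a ⊔ b) ⊓ c = (a ⊓ c) ⊔ b

/-- Neutral element of a lattice, via the median characterization
(equivalent to: every triple containing `a` generates a distributive
sublattice; Grätzer, "Lattice Theory: Foundation", Theorem 254). -/
def IsNeutralElt {L : Type*} [Lattice L] (a : L) : Prop :=
  ∀ b c : L, (a ⊓ b) ⊔ (b ⊓ c) ⊔ (c ⊓ a) = (a ⊔ b) ⊓ (b ⊔ c) ⊓ (c ⊔ a)

/-! ### Fully invariant congruences on commutative words -/

/-- Commutative words, written additively as exponent vectors; the zero vector is the empty word. -/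
abbrev CWord : Type := ℕ →₀ ℕ

/-- Substitution of commutative words for letters. -/
noncomputable abbrev substC (s : ℕ → CWord) : CWord →ₗ[ℕ] CWord :=
  Finsupp.linearCombination ℕ s

/-- A congruence that isolates the empty word and is preserved by all substitutions of nonempty
words: these are exactly the equational theories of commutative semigroups. -/
structure IsFullyInvariant (c : AddCon CWord) : Prop where
  eq_zero : ∀ f, c f 0 → f = 0
  subst : ∀ s : ℕ → CWord, (∀ i, s i ≠ 0) → ∀ f g, c f g → c (substC s f) (substC s g)

theorem substC_eq_zero_iff {s : ℕ → CWord} (hs : ∀ i, s i ≠ 0) (f : CWord) :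
    substC s f = 0 ↔ f = 0 := by
  refine ⟨fun h => ?_, fun h => by rw [h, map_zero]⟩
  by_contra hf
  obtain ⟨i, hi⟩ := Finsupp.ne_iff.1 hf
  have hle : Finsupp.single i 1 ≤ f := by
    rw [Finsupp.single_le_iff]
    exact Nat.one_le_iff_ne_zero.2 hi
  rw [← add_tsub_cancel_of_le hle, map_add, Finsupp.linearCombination_single, one_smul] at h
  exact hs i (add_eq_zero.1 h).1

/-- The congruence whose two classes are the empty word and the nonempty words. -/
def zeroCon : AddCon CWord where
  r f g := f = 0 ↔ g = 0
  iseqv := ⟨fun _ => Iff.rfl, Iff.symm, Iff.trans⟩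
  add' := by
    intro a b c d h1 h2
    simp only [add_eq_zero]
    rw [h1, h2]

theorem IsFullyInvariant.le_zeroCon {c : AddCon CWord} (hc : IsFullyInvariant c) :
    c ≤ zeroCon := by
  intro f g h
  constructor
  · rintro rfl
    exact hc.eq_zero _ (c.symm h)
  · rintro rfl
    exact hc.eq_zero _ h

theorem IsFullyInvariant.inf {c d : AddCon CWord} (hc : IsFullyInvariant c)
    (hd : IsFullyInvariant d) : IsFullyInvariant (c ⊓ d) :=
  ⟨fun f h => hc.eq_zero f h.1,
    fun s hs f g h => ⟨hc.subst s hs f g h.1, hd.subst s hs f g h.2⟩⟩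

theorem IsFullyInvariant.sup {c d : AddCon CWord} (hc : IsFullyInvariant c)
    (hd : IsFullyInvariant d) : IsFullyInvariant (c ⊔ d) := by
  refine ⟨fun f h => ?_, fun s hs f g h => ?_⟩
  · exact (sup_le hc.le_zeroCon hd.le_zeroCon h).2 rfl
  · have key : c ⊔ d ≤ (c ⊔ d).comap (substC s) (map_add _) := by
      refine sup_le (fun f g h => ?_) (fun f g h => ?_)
      · exact (le_sup_left : c ≤ c ⊔ d) (hc.subst s hs f g h)
      · exact (le_sup_right : d ≤ c ⊔ d) (hd.subst s hs f g h)
    exact key h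

/-- The join of two congruences on a commutative semigroup is reached by alternating chains. -/
theorem AddCon.reflTransGen_of_sup {M : Type*} [AddCommSemigroup M] {c d : AddCon M} {f g : M}
    (h : (c ⊔ d) f g) : Relation.ReflTransGen (fun x y => c x y ∨ d x y) f g := by
  have hsymm : Std.Symm (fun x y => c x y ∨ d x y) :=
    ⟨fun x y h => h.imp c.symm d.symm⟩
  let K : AddCon M :=
    { r := Relation.ReflTransGen (fun x y => c x y ∨ d x y)
      iseqv := ⟨fun _ => .refl, fun h => Relation.ReflTransGen.stdSymm.symm _ _ h,
        fun h h' => h.trans h'⟩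
      add' := by
        intro x y z w h1 h2
        refine Relation.ReflTransGen.trans (b := y + z) ?_ ?_
        · exact Relation.ReflTransGen.lift (· + z)
            (fun a b h => h.imp (fun h => c.add h (c.refl z)) (fun h => d.add h (d.refl z))) _ _ h1
        · exact Relation.ReflTransGen.lift (y + ·)
            (fun a b h => h.imp (fun h => c.add (c.refl y) h) (fun h => d.add (d.refl y) h)) _ _ h2 }
  have hle : c ⊔ d ≤ K := sup_le (fun x y h => .single (.inl h)) (fun x y h => .single (.inr h))
  exact hle h

theorem AddCon.mem_of_sup {M : Type*} [AddCommSemigroup M] {c d : AddCon M} {A : Set M}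
    (hc : ∀ f g, f ∈ A → c f g → g ∈ A) (hd : ∀ f g, f ∈ A → d f g → g ∈ A) {f g : M}
    (hf : f ∈ A) (h : (c ⊔ d) f g) : g ∈ A := by
  have hchain := AddCon.reflTransGen_of_sup h
  clear h
  induction hchain with
  | refl => exact hf
  | tail _ hstep ih => exact hstep.elim (hc _ _ ih) (hd _ _ ih)

/-- The theory of the abelian groups of exponent dividing `m`. -/
def groupCon (m : ℕ) : AddCon CWord where
  r f g := (f = 0 ↔ g = 0) ∧ ∃ p q : CWord, f + m • p = g + m • q
  iseqv := by
    refine ⟨fun f => ⟨Iff.rfl, 0, 0, rfl⟩, ?_, ?_⟩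
    · rintro f g ⟨h, p, q, e⟩
      exact ⟨h.symm, q, p, e.symm⟩
    · rintro f g k ⟨h, p, q, e⟩ ⟨h', p', q', e'⟩
      refine ⟨h.trans h', p + p', q + q', ?_⟩
      rw [smul_add, smul_add, ← add_assoc, e, add_right_comm, e']
      abel
  add' := by
    rintro f g k l ⟨h, p, q, e⟩ ⟨h', p', q', e'⟩
    refine ⟨by rw [add_eq_zero, add_eq_zero, h, h'], p + p', q + q', ?_⟩
    rw [smul_add, smul_add, add_add_add_comm, e, e', add_add_add_comm]

theorem groupCon_iff {m : ℕ} {f g : CWord} :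
    groupCon m f g ↔ (f = 0 ↔ g = 0) ∧ ∃ p q : CWord, f + m • p = g + m • q := Iff.rfl

theorem groupCon_isFullyInvariant (m : ℕ) : IsFullyInvariant (groupCon m) := by
  refine ⟨fun f h => h.1.2 rfl, ?_⟩
  rintro s hs f g ⟨h, p, q, e⟩
  refine ⟨by rw [substC_eq_zero_iff hs, substC_eq_zero_iff hs, h], substC s p, substC s q, ?_⟩
  rw [← map_nsmul, ← map_nsmul, ← map_add, ← map_add, e]

/-- Two words congruent modulo `m` agree at every letter at which both exponents are below `m`. -/
theorem groupCon.le_or_le {m : ℕ} {f g : CWord} (h : groupCon m f g) {x : ℕ} (hx : f x ≠ g x) :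
    m ≤ f x ∨ m ≤ g x := by
  obtain ⟨-, p, q, e⟩ := groupCon_iff.1 h
  by_contra! hlt
  have e' : f x + m * p x = g x + m * q x := by simpa using DFunLike.congr_fun e x
  have := congrArg (· % m) e'
  simp only [Nat.add_mul_mod_self_left, Nat.mod_eq_of_lt hlt.1, Nat.mod_eq_of_lt hlt.2] at this
  exact hx this

/-- Words of degree at least four are identified, and so are words of degree three with the same
letters. -/
def cubeCon : AddCon CWord where
  r f g := f = g ∨ (4 ≤ f.degree ∧ 4 ≤ g.degree) ∨
    (f.degree = 3 ∧ g.degree = 3 ∧ f.support = g.support)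
  iseqv := by
    refine ⟨fun f => .inl rfl, ?_, ?_⟩
    · rintro f g (h | h | h)
      · exact .inl h.symm
      · exact .inr (.inl h.symm)
      · exact .inr (.inr ⟨h.2.1, h.1, h.2.2.symm⟩)
    · rintro f g k (rfl | h | h) (rfl | h' | h')
      · exact .inl rfl
      · exact .inr (.inl h')
      · exact .inr (.inr h')
      · exact .inr (.inl h)
      · exact .inr (.inl ⟨h.1, h'.2⟩)
      · omega
      · exact .inr (.inr h)
      · omega
      · exact .inr (.inr ⟨h.1, h'.2.1, h.2.2.trans h'.2.2⟩)
  add' := by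
    intro f g k l h1 h2
    by_cases hk : k = 0 ∧ l = 0
    · obtain ⟨rfl, rfl⟩ := hk
      simpa using h1
    by_cases hf : f = 0 ∧ g = 0
    · obtain ⟨rfl, rfl⟩ := hf
      simpa using h2
    have pos : ∀ u : CWord, u ≠ 0 → 1 ≤ u.degree := fun u hu =>
      Nat.one_le_iff_ne_zero.2 (by rwa [Ne, Finsupp.degree_eq_zero_iff])
    simp only [map_add]
    by_cases e1 : f = g
    · subst e1
      by_cases e2 : k = l
      · exact .inl (by rw [e2])
      · have h0 := pos f (by tauto)
        have h3 : 3 ≤ k.degree ∧ 3 ≤ l.degree := by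
          rcases h2 with h | h | h
          · exact absurd h e2
          · omega
          · omega
        right; left; omega
    · have h4 : 3 ≤ f.degree ∧ 3 ≤ g.degree := by
        rcases h1 with h | h | h
        · exact absurd h e1
        · omega
        · omega
      have hk' : 1 ≤ k.degree ∧ 1 ≤ l.degree := by
        rcases h2 with rfl | h | h
        · have := pos k (by tauto)
          exact ⟨this, this⟩
        · omega
        · omega
      right; left; omega

theorem cubeCon_iff {f g : CWord} :
    cubeCon f g ↔ f = g ∨ (4 ≤ f.degree ∧ 4 ≤ g.degree) ∨
      (f.degree = 3 ∧ g.degree = 3 ∧ f.support = g.support) := Iff.rfl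

theorem degree_substC (s : ℕ → CWord) (f : CWord) :
    (substC s f).degree = ∑ i ∈ f.support, f i * (s i).degree := by
  rw [Finsupp.linearCombination_apply, Finsupp.sum, map_sum]
  simp

theorem support_substC (s : ℕ → CWord) (f : CWord) :
    (substC s f).support = f.support.biUnion fun i => (s i).support := by
  ext j
  simp [Finsupp.linearCombination_apply, Finsupp.sum, Finsupp.finsetSum_apply]

theorem degree_le_degree_substC {s : ℕ → CWord} (hs : ∀ i, s i ≠ 0) (f : CWord) :
    f.degree ≤ (substC s f).degree := by
  rw [degree_substC, Finsupp.degree_apply]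
  refine Finset.sum_le_sum fun i _ => Nat.le_mul_of_pos_right _ ?_
  rw [Nat.pos_iff_ne_zero, Ne, Finsupp.degree_eq_zero_iff]
  exact hs i

theorem degree_lt_degree_substC {s : ℕ → CWord} (hs : ∀ i, s i ≠ 0) {f : CWord} {i : ℕ}
    (hi : i ∈ f.support) (h : 2 ≤ (s i).degree) : f.degree < (substC s f).degree := by
  rw [degree_substC, Finsupp.degree_apply]
  refine Finset.sum_lt_sum (fun j _ => Nat.le_mul_of_pos_right _ ?_) ⟨i, hi, ?_⟩
  · rw [Nat.pos_iff_ne_zero, Ne, Finsupp.degree_eq_zero_iff]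
    exact hs j
  · have : 0 < f i := Nat.pos_iff_ne_zero.2 (Finsupp.mem_support_iff.1 hi)
    nlinarith

theorem cubeCon_isFullyInvariant : IsFullyInvariant cubeCon := by
  constructor
  · rintro f (h | h | h)
    · exact h
    · simp at h
    · simp at h
  · rintro s hs f g (rfl | h | h)
    · exact .inl rfl
    · exact .inr (.inl ⟨h.1.trans (degree_le_degree_substC hs f),
        h.2.trans (degree_le_degree_substC hs g)⟩)
    · by_cases hb : ∃ i ∈ f.support, 2 ≤ (s i).degree
      · obtain ⟨i, hi, h2⟩ := hb
        have h1 := degree_lt_degree_substC hs hi h2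
        have h3 := degree_lt_degree_substC hs (h.2.2 ▸ hi) h2
        exact .inr (.inl (by omega))
      · push Not at hb
        have key : ∀ u : CWord, u.support = f.support → (substC s u).degree = u.degree := by
          intro u hu
          rw [degree_substC, Finsupp.degree_apply]
          refine Finset.sum_congr rfl fun i hi => ?_
          have h1 := hb i (hu ▸ hi)
          have h2 : (s i).degree ≠ 0 := by
            rw [Ne, Finsupp.degree_eq_zero_iff]
            exact hs i
          rw [show (s i).degree = 1 by omega, mul_one]
        refine .inr (.inr ⟨(key f rfl).trans h.1, (key g h.2.2.symm).trans h.2.1, ?_⟩)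
        rw [support_substC, support_substC, h.2.2]

/-! ### Periodicity and raisable letters -/

open Finsupp in
theorem substC_ite (i : ℕ) (a b f : CWord) :
    substC (fun j => if j = i then a else b) f = f i • a + (f.erase i).degree • b := by
  induction f using Finsupp.induction_linear with
  | zero => simp
  | add f g hf hg =>
    rw [map_add, hf, hg, erase_add, map_add, Finsupp.add_apply, add_smul, add_smul, add_add_add_comm]
  | single j n =>
    rw [linearCombination_single]
    rcases eq_or_ne j i with rfl | h
    · simp
    · rw [erase_single_ne h.symm]
      simp [h]

/-- The identities `xⁱ = xⁱ⁺ᴺʲ` hold for all `i ≥ N`. -/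
def HasPeriod (N : ℕ) (c : AddCon CWord) : Prop :=
  ∀ x i j : ℕ, N ≤ i → c (Finsupp.single x i) (Finsupp.single x (i + N * j))

theorem HasPeriod.mono {N : ℕ} {c d : AddCon CWord} (h : HasPeriod N c) (hcd : c ≤ d) :
    HasPeriod N d := fun x i j hi => hcd (h x i j hi)

theorem AddCon.rel_add_nsmul {M : Type*} [AddCommMonoid M] {c : AddCon M} {u v : M}
    (h : c u (u + v)) (j : ℕ) : c u (u + j • v) := by
  induction j with
  | zero => simpa using c.refl u
  | succ j ih =>
    have h2 := c.add h (c.refl (j • v))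
    rw [succ_nsmul', ← add_assoc]
    exact c.trans ih h2

theorem IsFullyInvariant.exists_hasPeriod {α : AddCon CWord} (hα : IsFullyInvariant α)
    {f g : CWord} (h : α f g) (hne : f ≠ g) : ∃ N, 0 < N ∧ HasPeriod N α := by
  have step : ∃ p q, p < q ∧ α (Finsupp.single 0 p) (Finsupp.single 0 q) := by
    suffices ∃ p q, p ≠ q ∧ α (Finsupp.single 0 p) (Finsupp.single 0 q) by
      obtain ⟨p, q, hpq, h⟩ := this
      rcases lt_or_gt_of_ne hpq with h' | h'
      · exact ⟨p, q, h', h⟩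
      · exact ⟨q, p, h', α.symm h⟩
    obtain ⟨i, hi⟩ := Finsupp.ne_iff.1 hne
    have key : ∀ a : ℕ, 0 < a → α (Finsupp.single 0 (f i * a + (f.erase i).degree))
        (Finsupp.single 0 (g i * a + (g.erase i).degree)) := by
      intro a ha
      have := hα.subst (fun j => if j = i then Finsupp.single 0 a else Finsupp.single 0 1)
        (by intro j; split <;> simp; omega) f g h
      simpa only [substC_ite, Finsupp.smul_single, smul_eq_mul, mul_one,
        ← Finsupp.single_add] using this
    by_cases h1 : f i * 1 + (f.erase i).degree = g i * 1 + (g.erase i).degree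
    · exact ⟨_, _, by omega, key 2 two_pos⟩
    · exact ⟨_, _, h1, key 1 one_pos⟩
  obtain ⟨p, q, hpq, h⟩ := step
  have hp : p ≠ 0 := by
    rintro rfl
    rw [Finsupp.single_zero] at h
    have := hα.eq_zero _ (α.symm h)
    rw [Finsupp.single_eq_zero] at this
    omega
  obtain ⟨e, rfl⟩ := Nat.exists_eq_add_of_lt hpq
  refine ⟨p * (e + 1), by positivity, fun x i j hi => ?_⟩
  rw [add_assoc, Finsupp.single_add] at h
  have h2 := AddCon.rel_add_nsmul h (p * j)
  have h3 := hα.subst (fun _ => Finsupp.single x 1) (by simp) _ _ h2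
  rw [map_add, map_nsmul] at h3
  simp only [Finsupp.linearCombination_single, Finsupp.smul_single, smul_eq_mul, mul_one,
    ← Finsupp.single_add] at h3
  have hle : p ≤ i := le_trans (Nat.le_mul_of_pos_right _ (by omega)) hi
  have h4 := α.add h3 (α.refl (Finsupp.single x (i - p)))
  rw [← Finsupp.single_add, ← Finsupp.single_add] at h4
  have e1 : p + (i - p) = i := by omega
  have e2 : p + p * j * (e + 1) + (i - p) = i + p * (e + 1) * j := by
    rw [add_right_comm, e1]
    ring
  rw [e1, e2] at h4
  exact h4

/-- The exponent of the letter `x` in `f` may be raised by `N` modulo `c`. -/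
def Raisable (N : ℕ) (c : AddCon CWord) (f : CWord) (x : ℕ) : Prop :=
  c f (f + Finsupp.single x N)

namespace Raisable

variable {N : ℕ} {c d : AddCon CWord} {f g l : CWord} {x y : ℕ}

theorem mono (h : Raisable N c f x) (hcd : c ≤ d) : Raisable N d f x := hcd h

theorem congr (hfg : c f g) (h : Raisable N c f x) : Raisable N c g x :=
  c.trans (c.symm hfg) (c.trans h (c.add hfg (c.refl _)))

theorem add (h : Raisable N c f x) (g : CWord) : Raisable N c (f + g) x := by
  have := c.add h (c.refl g)
  rwa [add_right_comm] at this

theorem mono_word (h : Raisable N c f x) (hfg : f ≤ g) : Raisable N c g x := by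
  rw [← add_tsub_cancel_of_le hfg]
  exact h.add _

theorem of_le (hc : HasPeriod N c) (h : N ≤ f x) : Raisable N c f x := by
  refine mono_word (f := Finsupp.single x (f x)) ?_ (Finsupp.single_le_iff.2 le_rfl)
  have := hc x (f x) 1 h
  rwa [mul_one, Finsupp.single_add] at this

theorem rel_add_nsmul (h : ∀ y, l y ≠ 0 → Raisable N c f y) : c f (f + N • l) := by
  induction l using Finsupp.induction_linear with
  | zero => simpa using c.refl f
  | add l l' ih ih' =>
    have h1 := ih fun y hy => h y (by simp [hy])
    have h2 := ih' fun y hy => h y (by simp [hy])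
    rw [smul_add, ← add_assoc]
    exact c.trans h2 (c.trans (c.add h1 (c.refl _)) (c.refl _))
  | single y n =>
    rcases eq_or_ne n 0 with rfl | hn
    · simpa using c.refl f
    · have := AddCon.rel_add_nsmul (h y (by simpa using hn)) n
      rwa [Finsupp.smul_single, smul_eq_mul, mul_comm, ← smul_eq_mul, ← Finsupp.smul_single] at this

theorem of_add (hN : 0 < N) (hl : ∀ y, l y ≠ 0 → Raisable N c f y)
    (h : Raisable N c (f + l) x) : Raisable N c f x := by
  refine congr (c.symm (rel_add_nsmul hl)) ?_
  have := h.add ((N - 1) • l)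
  rwa [add_assoc, ← succ_nsmul', show N - 1 + 1 = N by omega] at this

theorem of_rel_add_single (hc : HasPeriod N c) {e : ℕ} (he : 0 < e)
    (h : c f (f + Finsupp.single x e)) : Raisable N c f x := by
  have h1 : c f (f + Finsupp.single x (N * e)) := by
    have := AddCon.rel_add_nsmul h N
    rwa [Finsupp.smul_single, smul_eq_mul] at this
  refine congr (c.symm h1) (of_le hc ?_)
  rw [Finsupp.add_apply, Finsupp.single_eq_same]
  exact le_add_left (Nat.le_mul_of_pos_right _ he)

/-- A letter outside of `f` that is raisable can be replaced by an arbitrary letter. -/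
theorem of_notMem (hc : IsFullyInvariant c) (h : Raisable N c f y) (hy : f y = 0) (x : ℕ) :
    Raisable N c f x := by
  have hs := hc.subst (fun j => if j = y then Finsupp.single x 1 else Finsupp.single j 1)
    (by intro j; split <;> simp) _ _ h
  have hf : substC (fun j => if j = y then Finsupp.single x 1 else Finsupp.single j 1) f = f := by
    rw [Finsupp.linearCombination_apply]
    conv_rhs => rw [← Finsupp.sum_single f]
    refine Finsupp.sum_congr fun j hj => ?_
    have : j ≠ y := by
      rintro rfl
      exact (Finsupp.mem_support_iff.1 hj) hy
    simp [this]
  rw [map_add, hf, Finsupp.linearCombination_single] at hs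
  simpa [Raisable] using hs

/-- Two letters with the same exponent are interchangeable. -/
theorem of_eq (hc : IsFullyInvariant c) (h : Raisable N c f x) (hxy : f x = f y) :
    Raisable N c f y := by
  have hs := hc.subst (fun j => Finsupp.single (Equiv.swap x y j) 1) (by simp) _ _ h
  have hsub : ∀ u : CWord, substC (fun j => Finsupp.single (Equiv.swap x y j) 1) u
      = u.mapDomain (Equiv.swap x y) := by
    intro u
    rw [Finsupp.linearCombination_apply, Finsupp.mapDomain]
    simp
  rw [hsub, hsub, Finsupp.mapDomain_add, Finsupp.mapDomain_single, Equiv.swap_apply_left] at hs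
  have hf : f.mapDomain (Equiv.swap x y) = f := by
    ext j
    rw [← Finsupp.equivMapDomain_eq_mapDomain, Finsupp.equivMapDomain_apply, Equiv.symm_swap]
    rcases eq_or_ne j x with rfl | hx
    · simp [hxy]
    rcases eq_or_ne j y with rfl | hy
    · simp [hxy]
    rw [Equiv.swap_apply_of_ne_of_ne hx hy]
  rwa [hf] at hs

end Raisable

/-! ### Lower-modular congruences -/

/-- Lower-modularity in the lattice of fully invariant congruences; it is the condition on
equational theories dual to upper-modularity of varieties. -/
def IsLowerModularCon (α : AddCon CWord) : Prop :=
  ∀ β γ, IsFullyInvariant β → IsFullyInvariant γ → α ≤ β → β ⊓ (α ⊔ γ) ≤ α ⊔ (β ⊓ γ)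

theorem zeroCon_le_sup_groupCon {N : ℕ} {α : AddCon CWord} (hα : IsFullyInvariant α)
    (hp : HasPeriod N α) : zeroCon ≤ α ⊔ groupCon (N + 1) := by
  set σ := α ⊔ groupCon (N + 1) with hσ
  have hασ : α ≤ σ := le_sup_left
  have hγσ : groupCon (N + 1) ≤ σ := le_sup_right
  have hFI : IsFullyInvariant σ := hα.sup (groupCon_isFullyInvariant _)
  have h1 : σ (Finsupp.single 0 1) (Finsupp.single 0 (N + 1)) := by
    have h2 : groupCon (N + 1) (Finsupp.single 0 1) (Finsupp.single 0 (N + 1 + N * N)) := by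
      refine groupCon_iff.2 ⟨by simp, Finsupp.single 0 N, 0, ?_⟩
      rw [Finsupp.smul_single, ← Finsupp.single_add, smul_zero, add_zero, smul_eq_mul]
      congr 1
      ring
    exact σ.trans (hγσ h2) (σ.symm (hασ (hp 0 (N + 1) N (by omega))))
  have h3 : ∀ f : CWord, f ≠ 0 → σ f ((N + 1) • Finsupp.single 0 1) := by
    intro f hf
    have h4 := hFI.subst (fun _ => f) (fun _ => hf) _ _ h1
    rw [Finsupp.linearCombination_single, Finsupp.linearCombination_single, one_smul] at h4
    have h5 : groupCon (N + 1) ((N + 1) • f) ((N + 1) • Finsupp.single 0 1) :=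
      groupCon_iff.2 ⟨by simp [hf], Finsupp.single 0 1, f, add_comm _ _⟩
    exact σ.trans h4 (hγσ h5)
  intro f g (h : f = 0 ↔ g = 0)
  by_cases hf : f = 0
  · rw [hf, h.1 hf]
    exact σ.refl 0
  · exact σ.trans (h3 f hf) (σ.symm (h3 g (mt h.2 hf)))

section

variable {N : ℕ} {α β : AddCon CWord}

theorem IsLowerModularCon.le_sup_inf_groupCon (hm : IsLowerModularCon α)
    (hα : IsFullyInvariant α) (hp : HasPeriod N α) (hβ : IsFullyInvariant β) (h : α ≤ β) :
    β ≤ α ⊔ (β ⊓ groupCon (N + 1)) :=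
  (le_inf le_rfl (hβ.le_zeroCon.trans (zeroCon_le_sup_groupCon hα hp))).trans
    (hm β _ hβ (groupCon_isFullyInvariant _) h)

theorem Raisable.subst_two_one (hα : IsFullyInvariant α) {x y : ℕ} (hxy : x ≠ y)
    (h : Raisable N α (Finsupp.single x 2 + Finsupp.single y 1) x) (z w : ℕ) :
    Raisable N α (Finsupp.single z 2 + Finsupp.single w 1) z := by
  have := hα.subst (fun j => if j = x then Finsupp.single z 1 else Finsupp.single w 1)
    (by intro j; split <;> simp) _ _ h
  simpa [Raisable, hxy.symm] using this

/-- If `α` preserves exponents up to the threshold two and is lower-modular, then the exponent of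
`x` in `x²y` can be raised. -/
theorem IsLowerModularCon.raisable_two_one (hm : IsLowerModularCon α)
    (hα : IsFullyInvariant α) (hN : 0 < N) (hp : HasPeriod N α)
    (hI : ∀ f g, α f g → ∀ i, min (f i) 2 = min (g i) 2) (x y : ℕ) :
    Raisable N α (Finsupp.single x 2 + Finsupp.single y 1) x := by
  suffices h : ¬ ∀ x y, x ≠ y → ¬ Raisable N α (Finsupp.single x 2 + Finsupp.single y 1) x by
    push Not at h
    obtain ⟨z, w, hzw, h⟩ := h
    exact h.subst_two_one hα hzw x y
  intro hno
  have iso : ∀ x y, x ≠ y → ∀ g, α (Finsupp.single x 2 + Finsupp.single y 1) g →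
      g = Finsupp.single x 2 + Finsupp.single y 1 := by
    intro x y hxy g h
    have hg : g = Finsupp.single x 2 + Finsupp.single y 1 + Finsupp.single x (g x - 2) := by
      ext j
      have hj := hI _ _ h j
      simp only [Finsupp.add_apply, Finsupp.single_apply] at hj ⊢
      split_ifs at hj ⊢ <;> (try subst_vars) <;> omega
    by_cases he : g x - 2 = 0
    · rwa [he, Finsupp.single_zero, add_zero] at hg
    · rw [hg] at h
      exact absurd (Raisable.of_rel_add_single hp (Nat.pos_of_ne_zero he) h) (hno x y hxy)
  set u : CWord := Finsupp.single 0 2 + Finsupp.single 1 1 with hu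
  set u' : CWord := Finsupp.single 1 2 + Finsupp.single 0 1 with hu'
  have du : u.degree = 3 := by simp [hu]
  have du' : u'.degree = 3 := by simp [hu']
  have su : u.support = {0, 1} := by
    ext j
    simp only [hu, Finsupp.mem_support_iff, Finsupp.add_apply, Finsupp.single_apply,
      Finset.mem_insert, Finset.mem_singleton]
    split_ifs <;> omega
  have su' : u'.support = {0, 1} := by
    ext j
    simp only [hu', Finsupp.mem_support_iff, Finsupp.add_apply, Finsupp.single_apply,
      Finset.mem_insert, Finset.mem_singleton]
    split_ifs <;> omega
  have eq_of : ∀ g : CWord, g.degree = 3 → g.support = {0, 1} → g = u ∨ g = u' := by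
    intro g hd hs
    have hsum : g 0 + g 1 = 3 := by
      rw [Finsupp.degree_apply, hs] at hd
      simpa using hd
    have h0 : g 0 ≠ 0 := Finsupp.mem_support_iff.1 (by simp [hs])
    have h1 : g 1 ≠ 0 := Finsupp.mem_support_iff.1 (by simp [hs])
    have hj : ∀ j, j ≠ 0 → j ≠ 1 → g j = 0 := fun j hj0 hj1 =>
      Finsupp.notMem_support_iff.1 (by simp [hs, hj0, hj1])
    rcases (show g 0 = 2 ∧ g 1 = 1 ∨ g 0 = 1 ∧ g 1 = 2 by omega) with h | h
    · left
      ext j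
      have := hj j
      simp only [hu, Finsupp.add_apply, Finsupp.single_apply]
      split_ifs <;> (try subst_vars) <;> omega
    · right
      ext j
      have := hj j
      simp only [hu', Finsupp.add_apply, Finsupp.single_apply]
      split_ifs <;> (try subst_vars) <;> omega
  have hclosed : ∀ g, (α ⊔ cubeCon) u g → g ∈ ({u, u'} : Set CWord) := by
    intro g hg
    refine AddCon.mem_of_sup ?_ ?_ (Set.mem_insert u {u'}) hg
    · rintro f g (rfl | rfl) h
      · exact .inl (iso 0 1 (by omega) g h)
      · exact .inr (iso 1 0 (by omega) g h)
    · rintro f g hf h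
      have hf3 : f.degree = 3 ∧ f.support = {0, 1} := by
        rcases hf with rfl | rfl
        · exact ⟨du, su⟩
        · exact ⟨du', su'⟩
      rcases cubeCon_iff.1 h with rfl | h | h
      · exact hf
      · omega
      · exact eq_of g h.2.1 (h.2.2 ▸ hf3.2)
  have hrel : (α ⊔ cubeCon) u u' :=
    (le_sup_right : cubeCon ≤ α ⊔ cubeCon)
      (cubeCon_iff.2 (.inr (.inr ⟨du, du', su.trans su'.symm⟩)))
  have hkey := hm.le_sup_inf_groupCon hα hp (hα.sup cubeCon_isFullyInvariant) le_sup_left hrel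
  have hne : ∀ m : ℕ, 2 ≤ m → ¬ groupCon m u u' := by
    rintro m hm2 h
    obtain ⟨-, p, q, e⟩ := groupCon_iff.1 h
    have e' : 2 + m * p 0 = 1 + m * q 0 := by simpa [hu, hu'] using DFunLike.congr_fun e 0
    have h1 : (m : ℤ) ∣ 1 := ⟨q 0 - p 0, by
      have : (2 + m * p 0 : ℤ) = 1 + m * q 0 := by exact_mod_cast e'
      linarith⟩
    have := Int.le_of_dvd one_pos h1
    omega
  have hmem : u' ∈ ({u} : Set CWord) := by
    refine AddCon.mem_of_sup ?_ ?_ (Set.mem_singleton u) hkey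
    · rintro f g rfl h
      exact iso 0 1 (by omega) g h
    · rintro f g rfl h
      rcases hclosed g h.1 with rfl | rfl
      · rfl
      · exact absurd h.2 (hne _ (by omega))
  have h0 := DFunLike.congr_fun (Set.mem_singleton_iff.1 hmem) 0
  simp [hu, hu'] at h0

/-- If `α` does not preserve exponents up to the threshold two, then every letter can be raised
in the presence of a letter with a large exponent. -/
theorem IsFullyInvariant.raisable_single_add (hα : IsFullyInvariant α) (hN : 0 < N)
    (hp : HasPeriod N α) {f g : CWord} (h : α f g) {i : ℕ} (hi : f i < g i) (hi1 : f i ≤ 1)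
    (x y : ℕ) : Raisable N α (Finsupp.single x 1 + Finsupp.single y N) x := by
  have h1 := hα.subst (fun j => if j = i then Finsupp.single x 1 else Finsupp.single y N)
    (by intro j; split <;> simp; omega) _ _ h
  rw [substC_ite, substC_ite] at h1
  simp only [Finsupp.smul_single, smul_eq_mul, mul_one] at h1
  have h2 : ∀ a d : ℕ, α (Finsupp.single x (a + (1 - f i)) + Finsupp.single y N)
      (Finsupp.single x a + Finsupp.single y (d * N)
        + (Finsupp.single x (1 - f i) + Finsupp.single y N)) := by
    intro a d
    have h3 := α.add (α.refl (Finsupp.single x (a + (1 - f i)))) (hp y N d le_rfl)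
    rw [show Finsupp.single x a + Finsupp.single y (d * N)
        + (Finsupp.single x (1 - f i) + Finsupp.single y N)
      = Finsupp.single x (a + (1 - f i)) + Finsupp.single y (N + N * d) by
        rw [mul_comm, Finsupp.single_add, Finsupp.single_add]; abel]
    exact h3
  have h4 := α.trans (h2 (f i) _) (α.trans (α.add h1 (α.refl _)) (α.symm (h2 (g i) _)))
  refine Raisable.of_rel_add_single hp (e := g i - f i) (by omega) ?_
  rw [add_right_comm, ← Finsupp.single_add]
  rw [show f i + (1 - f i) = 1 by omega, show g i + (1 - f i) = 1 + (g i - f i) by omega] at h4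
  exact h4

theorem single_add_single_le {f : CWord} {x y a b : ℕ} (hxy : x ≠ y) (ha : a ≤ f x)
    (hb : b ≤ f y) : Finsupp.single x a + Finsupp.single y b ≤ f := by
  intro j
  simp only [Finsupp.add_apply, Finsupp.single_apply]
  split_ifs <;> (try subst_vars) <;> omega

/-- Over a lower-modular `α`, letters of `f` that are not raisable modulo `α` are raisable
simultaneously modulo every larger congruence. -/
theorem IsLowerModularCon.raisable_of_raisable (hm : IsLowerModularCon α)
    (hα : IsFullyInvariant α) (hN : 0 < N) (hp : HasPeriod N α) (hβ : IsFullyInvariant β)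
    (hαβ : α ≤ β) {f : CWord} {x y : ℕ} (hx : f x ≠ 0) (hy : f y ≠ 0)
    (hnx : ¬ Raisable N α f x) (hny : ¬ Raisable N α f y) (h : Raisable N β f x) :
    Raisable N β f y := by
  rcases eq_or_ne x y with rfl | hxy
  · exact h
  by_cases hI : ∀ f g, α f g → ∀ i, min (f i) 2 = min (g i) 2
  · have one : ∀ z w, z ≠ w → f z ≠ 0 → f w ≠ 0 → ¬ Raisable N α f z → f z = 1 := by
      intro z w hzw hz hw hnz
      by_contra hz1
      exact hnz ((hm.raisable_two_one hα hN hp hI z w).mono_word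
        (single_add_single_le hzw (by omega) (by omega)))
    exact h.of_eq hβ ((one x y hxy hx hy hnx).trans (one y x hxy.symm hy hx hny).symm)
  · have hr : ∀ x y, Raisable N α (Finsupp.single x 1 + Finsupp.single y N) x := by
      push Not at hI
      obtain ⟨f, g, hfg, i, hi⟩ := hI
      rcases lt_or_ge (f i) (g i) with hlt | hge
      · exact hα.raisable_single_add hN hp hfg hlt (by omega)
      · exact hα.raisable_single_add hN hp (α.symm hfg) (i := i) (by omega) (by omega)
    refine Raisable.congr (β.symm h) (((hr y x).mono_word ?_).mono hαβ)
    refine single_add_single_le hxy.symm ?_ (by simp)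
    simp only [Finsupp.add_apply]
    omega

end

section

variable {N : ℕ} {α β ω c : AddCon CWord}

theorem IsLowerModularCon.exists_raisable_of_sup (hm : IsLowerModularCon α)
    (hα : IsFullyInvariant α) (hN : 0 < N) (hp : HasPeriod N α) (hω : IsFullyInvariant ω)
    (hc : IsFullyInvariant c) (hαω : α ≤ ω) (hαc : α ≤ c) {f : CWord} {x : ℕ}
    (h : Raisable N (ω ⊔ c) f x) (hx : ¬ Raisable N α f x) :
    ∃ y, ¬ Raisable N α f y ∧ (Raisable N ω f y ∨ Raisable N c f y) := by
  by_contra! hno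
  set A : Set CWord := {g | ∃ l l' : CWord, (∀ y, l y ≠ 0 → Raisable N α f y) ∧
    (∀ y, l' y ≠ 0 → Raisable N α f y) ∧ α (g + l) (f + l')} with hA
  have pull : ∀ δ : AddCon CWord, α ≤ δ → ∀ g ∈ A, ∀ y, Raisable N δ g y → Raisable N δ f y := by
    rintro δ hδ g ⟨l, l', -, hl', h⟩ y hy
    exact Raisable.of_add hN (fun z hz => (hl' z hz).mono hδ) (.congr (hδ h) (hy.add l))
  have closed : ∀ δ : AddCon CWord, IsFullyInvariant δ → α ≤ δ →
      (∀ y, Raisable N δ f y → Raisable N α f y) → ∀ g g', g ∈ A → δ g g' → g' ∈ A := by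
    intro δ hδ hαδ hr g g' hg h
    refine AddCon.mem_of_sup ?_ ?_ hg (hm.le_sup_inf_groupCon hα hp hδ hαδ h)
    · rintro u v ⟨l, l', hl, hl', h⟩ huv
      exact ⟨l, l', hl, hl', α.trans (α.add (α.symm huv) (α.refl l)) h⟩
    · rintro u v hu huv
      have hne : ∀ y, u y ≠ v y → Raisable N α f y := by
        intro y hy
        refine hr y (pull δ hαδ u hu y ?_)
        rcases groupCon.le_or_le huv.2 hy with h | h
        · exact .of_le (hp.mono hαδ) (by omega)
        · exact .congr (δ.symm huv.1) (.of_le (hp.mono hαδ) (by omega))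
      obtain ⟨l, l', hl, hl', h⟩ := hu
      refine ⟨u - v + l, v - u + l', fun y hy => ?_, fun y hy => ?_, ?_⟩
      · by_cases h0 : l y = 0
        · refine hne y fun he => hy ?_
          simp [h0, he]
        · exact hl y h0
      · by_cases h0 : l' y = 0
        · refine hne y fun he => hy ?_
          simp [h0, he]
        · exact hl' y h0
      · have e1 : v + (u - v + l) = (u + l) + (v - u) := by
          ext j
          simp only [Finsupp.add_apply, Finsupp.tsub_apply]
          omega
        rw [e1, add_comm (v - u) l', ← add_assoc]
        exact α.add h (α.refl _)
  have hmem : f + Finsupp.single x N ∈ A :=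
    AddCon.mem_of_sup
      (closed ω hω hαω fun y hy => by_contra fun h => (hno y h).1 hy)
      (closed c hc hαc fun y hy => by_contra fun h => (hno y h).2 hy)
      ⟨0, 0, by simp, by simp, α.refl _⟩ h
  exact hx (pull α le_rfl _ hmem x (.of_le hp (by simp)))

theorem IsLowerModularCon.raisable_modular (hm : IsLowerModularCon α)
    (hα : IsFullyInvariant α) (hN : 0 < N) (hp : HasPeriod N α) (hβ : IsFullyInvariant β)
    (hω : IsFullyInvariant ω) (hc : IsFullyInvariant c) (hαω : α ≤ ω) (hωβ : ω ≤ β)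
    (hαc : α ≤ c) {f : CWord} {x : ℕ} (h : Raisable N (β ⊓ (ω ⊔ c)) f x) :
    Raisable N (ω ⊔ (β ⊓ c)) f x := by
  classical
  induction hn : (f.support.filter fun y => ¬ Raisable N α f y).card
    using Nat.strong_induction_on generalizing f with
  | _ n ih =>
  have hωτ : ω ≤ ω ⊔ (β ⊓ c) := le_sup_left
  have hcτ : β ⊓ c ≤ ω ⊔ (β ⊓ c) := le_sup_right
  by_cases hx : Raisable N α f x
  · exact hx.mono (hαω.trans hωτ)
  obtain ⟨y, hy, hyr⟩ := hm.exists_raisable_of_sup hα hN hp hω hc hαω hαc h.2 hx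
  by_cases hy0 : f y = 0
  · rcases hyr with hyr | hyr
    · exact (hyr.of_notMem hω hy0 x).mono hωτ
    · exact Raisable.mono (c := β ⊓ c) ⟨h.1, hyr.of_notMem hc hy0 x⟩ hcτ
  have hyτ : Raisable N (ω ⊔ (β ⊓ c)) f y := by
    rcases hyr with hyr | hyr
    · exact hyr.mono hωτ
    · refine Raisable.mono (c := β ⊓ c) ⟨?_, hyr⟩ hcτ
      by_cases hx0 : f x = 0
      · exact Raisable.of_notMem hβ h.1 hx0 y
      · exact hm.raisable_of_raisable hα hN hp hβ (hαω.trans hωβ) hx0 hy0 hx hy h.1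
  refine .congr ((ω ⊔ (β ⊓ c)).symm hyτ) (ih _ ?_ (h.add _) rfl)
  rw [← hn]
  refine Finset.card_lt_card (Finset.ssubset_iff_subset_ne.2 ⟨fun z hz => ?_, fun he => ?_⟩)
  · simp only [Finset.mem_filter, Finsupp.mem_support_iff, Finsupp.add_apply] at hz ⊢
    refine ⟨?_, fun hr => hz.2 (hr.add _)⟩
    rcases eq_or_ne z y with rfl | hzy
    · exact hy0
    · simpa [hzy] using hz.1
  · have hmem : y ∈ f.support.filter fun y => ¬ Raisable N α f y := by simp [hy0, hy]
    rw [← he] at hmem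
    exact (Finset.mem_filter.1 hmem).2 (.of_le hp (by simp))

/-- The differences of large exponents of `c`-equivalent powers of a letter. -/
def exponentGroup (N : ℕ) (c : AddCon CWord) : AddSubgroup ℤ where
  carrier := {z | ∃ i j : ℕ, N ≤ i ∧ N ≤ j ∧ z = i - j ∧
    c (Finsupp.single 0 i) (Finsupp.single 0 j)}
  zero_mem' := ⟨N, N, le_rfl, le_rfl, by simp, c.refl _⟩
  add_mem' := by
    rintro _ _ ⟨i, j, hi, hj, rfl, h⟩ ⟨i', j', hi', hj', rfl, h'⟩
    refine ⟨i + i', j + j', by omega, by omega, by push_cast; ring, ?_⟩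
    rw [Finsupp.single_add, Finsupp.single_add]
    exact c.add h h'
  neg_mem' := by
    rintro _ ⟨i, j, hi, hj, rfl, h⟩
    exact ⟨j, i, hj, hi, by ring, c.symm h⟩

theorem mem_exponentGroup {z : ℤ} : z ∈ exponentGroup N c ↔ ∃ i j : ℕ, N ≤ i ∧ N ≤ j ∧
    z = i - j ∧ c (Finsupp.single 0 i) (Finsupp.single 0 j) := Iff.rfl

theorem exponentGroup_mono (h : ω ≤ c) : exponentGroup N ω ≤ exponentGroup N c := by
  rintro _ ⟨i, j, hi, hj, rfl, h'⟩
  exact ⟨i, j, hi, hj, rfl, h h'⟩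

theorem IsFullyInvariant.rel_single (hc : IsFullyInvariant c) (hN : 0 < N) (hp : HasPeriod N c)
    {i j : ℕ} (hi : N ≤ i) (hj : N ≤ j) (h : (i - j : ℤ) ∈ exponentGroup N c) (x : ℕ) :
    c (Finsupp.single x i) (Finsupp.single x j) := by
  obtain ⟨i', j', -, -, e, h⟩ := mem_exponentGroup.1 h
  have h1 := hc.subst (fun _ => Finsupp.single x 1) (by simp) _ _ h
  simp only [Finsupp.linearCombination_single, Finsupp.smul_single, smul_eq_mul, mul_one] at h1
  have hle : i' ≤ N * i' := Nat.le_mul_of_pos_left _ hN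
  have h2 := c.add h1 (c.refl (Finsupp.single x (i + N * i' - i')))
  rw [← Finsupp.single_add, ← Finsupp.single_add,
    show i' + (i + N * i' - i') = i + N * i' by omega,
    show j' + (i + N * i' - i') = j + N * i' by omega] at h2
  exact c.trans (hp x i i' hi) (c.trans h2 (c.symm (hp x j i' hj)))

theorem IsFullyInvariant.sub_mem_exponentGroup (hc : IsFullyInvariant c) (hN : 0 < N)
    (hp : HasPeriod N c) {f g : CWord} (h : c f g) (x : ℕ) :
    (f x - g x : ℤ) ∈ exponentGroup N c := by
  have hmem : (N : ℤ) ∈ exponentGroup N c :=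
    ⟨N + N * 1, N, by omega, le_rfl, by push_cast; ring, c.symm (hp 0 N 1 le_rfl)⟩
  have h1 := hc.subst (fun j => if j = x then Finsupp.single 0 1 else Finsupp.single 0 N)
    (by intro j; split <;> simp; omega) _ _ h
  rw [substC_ite, substC_ite] at h1
  have h2 := c.add h1 (c.refl (Finsupp.single 0 N))
  simp only [Finsupp.smul_single, smul_eq_mul, mul_one, ← Finsupp.single_add] at h2
  have h3 : ((f x + (f.erase x).degree * N + N : ℕ) - (g x + (g.erase x).degree * N + N : ℕ) : ℤ)
      ∈ exponentGroup N c := ⟨_, _, by omega, by omega, rfl, h2⟩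
  have h4 := sub_mem h3 (zsmul_mem hmem ((f.erase x).degree - (g.erase x).degree : ℤ))
  convert h4 using 1
  push_cast
  rw [smul_eq_mul]
  ring

/-- Words whose exponents agree modulo the subgroup `H`. -/
def exponentCon (H : AddSubgroup ℤ) : AddCon CWord where
  r f g := ∀ x, (f x - g x : ℤ) ∈ H
  iseqv := by
    refine ⟨fun f x => by simp, fun {f g} h x => ?_, fun {f g k} h h' x => ?_⟩
    · simpa using neg_mem (h x)
    · simpa using add_mem (h x) (h' x)
  add' := by
    intro f g k l h h' x
    convert add_mem (h x) (h' x) using 1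
    push_cast [Finsupp.add_apply]
    ring

theorem sub_mem_exponentGroup_modular (hN : 0 < N) (hp : HasPeriod N ω) (hp' : HasPeriod N c)
    (hβ : IsFullyInvariant β) (hω : IsFullyInvariant ω) (hc : IsFullyInvariant c) (hωβ : ω ≤ β)
    {f g : CWord} (h : (β ⊓ (ω ⊔ c)) f g) (x : ℕ) :
    (f x - g x : ℤ) ∈ exponentGroup N (ω ⊔ (β ⊓ c)) := by
  have hsup : ω ⊔ c ≤ exponentCon (exponentGroup N ω ⊔ exponentGroup N c) :=
    sup_le (fun f g h x => AddSubgroup.mem_sup_left (hω.sub_mem_exponentGroup hN hp h x))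
      (fun f g h x => AddSubgroup.mem_sup_right (hc.sub_mem_exponentGroup hN hp' h x))
  obtain ⟨a, ha, b, hb, hab⟩ := AddSubgroup.mem_sup.1 (hsup h.2 x)
  have hbβ : b ∈ exponentGroup N β := by
    rw [eq_sub_of_add_eq' hab]
    exact sub_mem (hβ.sub_mem_exponentGroup hN (hp.mono hωβ) h.1 x) (exponentGroup_mono hωβ ha)
  rw [← hab]
  refine add_mem (exponentGroup_mono le_sup_left ha) (exponentGroup_mono le_sup_right ?_)
  obtain ⟨i, j, hi, hj, rfl, hij⟩ := hb
  exact ⟨i, j, hi, hj, rfl, hβ.rel_single hN (hp.mono hωβ) hi hj hbβ 0, hij⟩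

theorem IsFullyInvariant.rel_of_sub_mem (hc : IsFullyInvariant c) (hN : 0 < N)
    (hp : HasPeriod N c) {f g : CWord} (h : ∀ x, f x = g x ∨ (N ≤ f x ∧ N ≤ g x))
    (h' : ∀ x, (f x - g x : ℤ) ∈ exponentGroup N c) : c f g := by
  have key : ∀ (s : Finset ℕ) (u : CWord), u.support ⊆ s →
      u = ∑ x ∈ s, Finsupp.single x (u x) := by
    intro s u hu
    conv_lhs => rw [← Finsupp.sum_single u]
    exact Finsupp.sum_of_support_subset _ hu _ (by simp)
  have hsum : c (∑ x ∈ f.support ∪ g.support, Finsupp.single x (f x))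
      (∑ x ∈ f.support ∪ g.support, Finsupp.single x (g x)) := by
    refine AddCon.finsetSum c _ fun x _ => ?_
    rcases h x with h | h
    · rw [h]
      exact c.refl _
    · exact hc.rel_single hN hp h.1 h.2 (h' x) x
  rwa [← key _ f Finset.subset_union_left, ← key _ g Finset.subset_union_right] at hsum

theorem IsLowerModularCon.modular_of_le (hm : IsLowerModularCon α)
    (hα : IsFullyInvariant α) (hN : 0 < N) (hp : HasPeriod N α) (hβ : IsFullyInvariant β)
    (hω : IsFullyInvariant ω) (hc : IsFullyInvariant c) (hαω : α ≤ ω) (hωβ : ω ≤ β)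
    (hαc : α ≤ c) : β ⊓ (ω ⊔ c) ≤ ω ⊔ (β ⊓ c) := by
  set θ := β ⊓ (ω ⊔ c) with hθ
  set τ := ω ⊔ (β ⊓ c) with hτ
  have hαθ : α ≤ θ := le_inf (hαω.trans hωβ) (hαω.trans le_sup_left)
  have hατ : α ≤ τ := hαω.trans le_sup_left
  have hτFI : IsFullyInvariant τ := hω.sup (hβ.inf hc)
  refine (hm.le_sup_inf_groupCon hα hp (hβ.inf (hω.sup hc)) hαθ).trans (sup_le hατ ?_)
  intro f g h
  have hfg : ∀ x, f x ≠ g x → Raisable N τ f x ∧ Raisable N τ g x := by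
    intro x hx
    have hf : Raisable N θ f x := by
      rcases groupCon.le_or_le h.2 hx with h' | h'
      · exact .of_le (hp.mono hαθ) (by omega)
      · exact .congr (θ.symm h.1) (.of_le (hp.mono hαθ) (by omega))
    exact ⟨hm.raisable_modular hα hN hp hβ hω hc hαω hωβ hαc hf,
      hm.raisable_modular hα hN hp hβ hω hc hαω hωβ hαc (.congr h.1 hf)⟩
  set l : CWord := (f - g) + (g - f) with hl
  have hlne : ∀ x, l x ≠ 0 → f x ≠ g x := by
    intro x hx he
    simp [hl, he] at hx
  refine τ.trans (Raisable.rel_add_nsmul fun x hx => (hfg x (hlne x hx)).1)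
    (τ.trans ?_ (τ.symm (Raisable.rel_add_nsmul fun x hx => (hfg x (hlne x hx)).2)))
  refine hτFI.rel_of_sub_mem hN (hp.mono hατ) (fun x => ?_) (fun x => ?_)
  · by_cases hx : f x = g x
    · exact .inl (by simp [hx])
    · right
      have hlx : 1 ≤ l x := by
        simp only [hl, Finsupp.add_apply, Finsupp.tsub_apply]
        omega
      have : N ≤ N * l x := Nat.le_mul_of_pos_right _ hlx
      simp only [Finsupp.add_apply, Finsupp.smul_apply, smul_eq_mul]
      omega
  · have := sub_mem_exponentGroup_modular hN (hp.mono hαω) (hp.mono hαc) hβ hω hc hωβ h.1 x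
    simpa using this

/-- Lower-modularity of a nontrivial congruence is inherited by larger congruences. -/
theorem IsLowerModularCon.of_le (hm : IsLowerModularCon α) (hα : IsFullyInvariant α)
    (hne : ∃ f g, α f g ∧ f ≠ g) (hω : IsFullyInvariant ω) (hαω : α ≤ ω) :
    IsLowerModularCon ω := by
  obtain ⟨f, g, hfg, hne⟩ := hne
  obtain ⟨N, hN, hp⟩ := hα.exists_hasPeriod hfg hne
  intro β γ hβ hγ hωβ
  calc β ⊓ (ω ⊔ γ) ≤ β ⊓ (ω ⊔ (α ⊔ γ)) := inf_le_inf_left _ (sup_le_sup_left le_sup_right _)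
    _ ≤ ω ⊔ (β ⊓ (α ⊔ γ)) :=
      hm.modular_of_le hα hN hp hβ hω (hα.sup hγ) hαω hωβ le_sup_left
    _ ≤ ω ⊔ (α ⊔ (β ⊓ γ)) := sup_le_sup_left (hm β γ hβ hγ (hαω.trans hωβ)) _
    _ ≤ ω ⊔ (β ⊓ γ) := sup_le le_sup_left (sup_le_sup_right hαω _)

end

/-! ### Commutative varieties and fully invariant congruences -/

/-- The exponent vector of a word. -/
noncomputable def content (w : Word) : CWord :=
  (FreeSemigroup.lift (fun i => Multiplicative.ofAdd (Finsupp.single i 1 : CWord)) w).toAdd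

theorem content_of (i : ℕ) : content (FreeSemigroup.of i) = Finsupp.single i 1 := rfl

theorem content_mul (u v : Word) : content (u * v) = content u + content v := by
  simp [content]

theorem content_ne_zero (w : Word) : content w ≠ 0 := by
  induction w using FreeSemigroup.recOnMul with
  | ih1 i => simp [content_of]
  | ih2 i w hi hw => simp [content_mul, hi]

theorem exists_content_eq {f : CWord} (hf : f ≠ 0) : ∃ w, content w = f := by
  have key : ∀ f : CWord, f = 0 ∨ ∃ w, content w = f := by
    intro f
    induction f using Finsupp.induction_linear with
    | zero => exact .inl rfl
    | add f g hf hg =>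
      rcases hf with rfl | ⟨u, rfl⟩
      · rwa [zero_add]
      rcases hg with rfl | ⟨v, rfl⟩
      · exact .inr ⟨u, (add_zero _).symm⟩
      · exact .inr ⟨u * v, content_mul u v⟩
    | single i n =>
      induction n with
      | zero => exact .inl (Finsupp.single_zero i)
      | succ n ih =>
        right
        rw [Finsupp.single_add]
        rcases ih with h | ⟨u, hu⟩
        · exact ⟨FreeSemigroup.of i, by rw [h, zero_add, content_of]⟩
        · exact ⟨u * FreeSemigroup.of i, by rw [content_mul, hu, content_of]⟩
  exact (key f).resolve_left hf

theorem content_lift (w : ℕ → Word) (u : Word) :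
    content (FreeSemigroup.lift w u) = substC (fun i => content (w i)) (content u) := by
  induction u using FreeSemigroup.recOnMul with
  | ih1 i => simp [content_of]
  | ih2 i u hi hu => rw [map_mul, content_mul, content_mul, map_add, hi, hu]

theorem coe_lift_eq_prod {S : Type} [CommSemigroup S] (σ : ℕ → S) (u : Word) :
    ((FreeSemigroup.lift σ u : S) : WithOne S)
      = (content u).prod fun i n => (σ i : WithOne S) ^ n := by
  induction u using FreeSemigroup.recOnMul with
  | ih1 i => simp [content_of]
  | ih2 i u hi hu =>
    rw [map_mul, WithOne.coe_mul, hi, hu, content_mul,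
      Finsupp.prod_add_index' (by simp) (by simp [pow_add])]

theorem satS_of_content_eq {S : Type} [Semigroup S] (hS : SatS S commId) {u v : Word}
    (h : content u = content v) : SatS S (u, v) := by
  intro σ
  let _ : CommSemigroup S := { (inferInstance : Semigroup S) with
    mul_comm := fun a b => by
      simpa [commId, xw, yw] using hS fun n => if n = 0 then a else b }
  apply WithOne.coe_injective
  rw [coe_lift_eq_prod σ u, coe_lift_eq_prod σ v, h]

theorem SgVariety.mem_th_iff (V : SgVariety) {e : SgId} :
    e ∈ V.th ↔ ∀ (S : Type) [Semigroup S], Models S V.th → SatS S e :=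
  (Set.ext_iff.1 V.closed e).symm

theorem mem_th_of_content_eq (V : ComVariety) {u v : Word} (h : content u = content v) :
    (u, v) ∈ V.1.th :=
  V.1.mem_th_iff.2 fun _ _ hS => satS_of_content_eq (hS _ V.2) h

theorem SgVariety.symm_mem (V : SgVariety) {u v : Word} (h : (u, v) ∈ V.th) : (v, u) ∈ V.th :=
  V.mem_th_iff.2 fun _ _ hS σ => (hS _ h σ).symm

theorem SgVariety.trans_mem (V : SgVariety) {u v w : Word} (h : (u, v) ∈ V.th)
    (h' : (v, w) ∈ V.th) : (u, w) ∈ V.th :=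
  V.mem_th_iff.2 fun _ _ hS σ => (hS _ h σ).trans (hS _ h' σ)

theorem SgVariety.mul_mem (V : SgVariety) {u v u' v' : Word} (h : (u, v) ∈ V.th)
    (h' : (u', v') ∈ V.th) : (u * u', v * v') ∈ V.th :=
  V.mem_th_iff.2 fun _ _ hS σ => by
    have h1 := hS _ h σ
    have h2 := hS _ h' σ
    simp only [map_mul] at h1 h2 ⊢
    rw [h1, h2]

theorem lift_lift {S : Type*} [Semigroup S] (σ : ℕ → S) (w : ℕ → Word) (u : Word) :
    FreeSemigroup.lift σ (FreeSemigroup.lift w u)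
      = FreeSemigroup.lift (fun i => FreeSemigroup.lift σ (w i)) u := by
  induction u using FreeSemigroup.recOnMul with
  | ih1 i => simp
  | ih2 i u hi hu => simp only [map_mul, hi, hu]

theorem SgVariety.subst_mem (V : SgVariety) {u v : Word} (h : (u, v) ∈ V.th) (w : ℕ → Word) :
    (FreeSemigroup.lift w u, FreeSemigroup.lift w v) ∈ V.th :=
  V.mem_th_iff.2 fun _ _ hS σ => by
    simp only [lift_lift]
    exact hS _ h _

/-- The congruence on commutative words given by the theory of a commutative variety. -/
def theoryCon (V : ComVariety) : AddCon CWord where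
  r f g := (f = 0 ↔ g = 0) ∧ ∀ u v, content u = f → content v = g → (u, v) ∈ V.1.th
  iseqv := by
    refine ⟨fun f => ⟨Iff.rfl, fun u v hu hv => mem_th_of_content_eq V (hu.trans hv.symm)⟩,
      fun {f g} h => ⟨h.1.symm, fun u v hu hv => V.1.symm_mem (h.2 v u hv hu)⟩,
      fun {f g k} h h' => ⟨h.1.trans h'.1, fun u v hu hv => ?_⟩⟩
    obtain ⟨w, hw⟩ := exists_content_eq (mt h.1.2 (hu ▸ content_ne_zero u))
    exact V.1.trans_mem (h.2 u w hu hw) (h'.2 w v hw hv)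
  add' := by
    intro f g k l h h'
    by_cases hf : f = 0
    · have hg := h.1.1 hf
      subst hf hg
      simpa using h'
    by_cases hk : k = 0
    · have hl := h'.1.1 hk
      subst hk hl
      simpa using h
    obtain ⟨u, hu⟩ := exists_content_eq hf
    obtain ⟨v, hv⟩ := exists_content_eq (mt h.1.2 hf)
    obtain ⟨u', hu'⟩ := exists_content_eq hk
    obtain ⟨v', hv'⟩ := exists_content_eq (mt h'.1.2 hk)
    refine ⟨by simp only [add_eq_zero, h.1, h'.1], fun a b ha hb => ?_⟩
    refine V.1.trans_mem (mem_th_of_content_eq V (v := u * u') ?_)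
      (V.1.trans_mem (V.1.mul_mem (h.2 u v hu hv) (h'.2 u' v' hu' hv'))
        (mem_th_of_content_eq V ?_))
    · rw [ha, content_mul, hu, hu']
    · rw [hb, content_mul, hv, hv']

theorem theoryCon_iff {V : ComVariety} {f g : CWord} : theoryCon V f g ↔
    (f = 0 ↔ g = 0) ∧ ∀ u v, content u = f → content v = g → (u, v) ∈ V.1.th := Iff.rfl

theorem theoryCon_content {V : ComVariety} {u v : Word} :
    theoryCon V (content u) (content v) ↔ (u, v) ∈ V.1.th := by
  refine ⟨fun h => h.2 u v rfl rfl, fun h => theoryCon_iff.2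
    ⟨by simp [content_ne_zero], fun a b ha hb => ?_⟩⟩
  exact V.1.trans_mem (mem_th_of_content_eq V ha)
    (V.1.trans_mem h (mem_th_of_content_eq V hb.symm))

/-- Congruences isolating the empty word are compared on contents of words. -/
theorem le_of_content {c d : AddCon CWord} (hc : c ≤ zeroCon)
    (h : ∀ u v, c (content u) (content v) → d (content u) (content v)) : c ≤ d := by
  intro f g hfg
  have h0 : f = 0 ↔ g = 0 := hc hfg
  by_cases hf : f = 0
  · rw [hf, h0.1 hf]
    exact d.refl 0
  · obtain ⟨u, rfl⟩ := exists_content_eq hf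
    obtain ⟨v, rfl⟩ := exists_content_eq (mt h0.2 hf)
    exact h u v hfg

theorem theoryCon_isFullyInvariant (V : ComVariety) : IsFullyInvariant (theoryCon V) := by
  refine ⟨fun f h => h.1.2 rfl, fun s hs => ?_⟩
  choose w hw using fun i => exists_content_eq (hs i)
  have key : theoryCon V ≤ (theoryCon V).comap (substC s) (map_add _) := by
    refine le_of_content (fun f g h => h.1) fun u v h => ?_
    have h1 := theoryCon_content.2 (V.1.subst_mem (theoryCon_content.1 h) w)
    rw [content_lift, content_lift] at h1
    simpa only [AddCon.comap_rel, hw] using h1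
  exact fun f g h => key h

theorem theoryCon_le_theoryCon {V W : ComVariety} : theoryCon V ≤ theoryCon W ↔ W ≤ V := by
  constructor
  · rintro h ⟨u, v⟩ he
    exact theoryCon_content.1 (h (theoryCon_content.2 he))
  · intro h f g hfg
    exact ⟨hfg.1, fun u v hu hv => h (hfg.2 u v hu hv)⟩

theorem theoryCon_sup (V W : ComVariety) : theoryCon (V ⊔ W) = theoryCon V ⊓ theoryCon W := by
  refine le_antisymm (le_inf (theoryCon_le_theoryCon.2 le_sup_left)
    (theoryCon_le_theoryCon.2 le_sup_right)) fun f g h => ?_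
  exact ⟨h.1.1, fun u v hu hv => ⟨h.1.2 u v hu hv, h.2.2 u v hu hv⟩⟩

/-- The identities whose sides have congruent contents. -/
def contentTheory (c : AddCon CWord) : Set SgId := {e | c (content e.1) (content e.2)}

theorem eqTh_contentTheory {c : AddCon CWord} (hc : IsFullyInvariant c) :
    eqTh (contentTheory c) = contentTheory c := by
  refine Set.Subset.antisymm (fun e he => ?_) (subset_eqTh _)
  let K : Con Word :=
    { r := fun u v => c (content u) (content v)
      iseqv := ⟨fun _ => c.refl _, c.symm, c.trans⟩
      mul' := fun h h' => by
        rw [content_mul, content_mul]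
        exact c.add h h' }
  have hlift : ∀ (w : ℕ → Word) (u : Word),
      FreeSemigroup.lift (fun i => (w i : K.Quotient)) u
        = ((FreeSemigroup.lift w u : Word) : K.Quotient) := by
    intro w u
    induction u using FreeSemigroup.recOnMul with
    | ih1 i => simp
    | ih2 i u hi hu => rw [map_mul, map_mul, hi, hu, Con.coe_mul]
  have hmodel : Models K.Quotient (contentTheory c) := by
    intro e' he' σ
    choose w hw using fun i => Quotient.exists_rep (σ i)
    obtain rfl : (fun i => (w i : K.Quotient)) = σ := funext hw
    rw [hlift, hlift]
    refine (Con.eq K).2 ?_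
    change c _ _
    rw [content_lift, content_lift]
    exact hc.subst _ (fun i => content_ne_zero _) _ _ he'
  have h := he K.Quotient hmodel fun i => (FreeSemigroup.of i : K.Quotient)
  rw [hlift, hlift] at h
  have hid : ∀ u : Word, FreeSemigroup.lift FreeSemigroup.of u = u := by
    intro u
    induction u using FreeSemigroup.recOnMul with
    | ih1 i => simp
    | ih2 i u hi hu => rw [map_mul, hi, hu]
  rw [hid, hid] at h
  exact (Con.eq K).1 h

/-- The commutative variety defined by a fully invariant congruence. -/
def varietyOfCon (c : AddCon CWord) (hc : IsFullyInvariant c) : ComVariety :=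
  ⟨⟨contentTheory c, eqTh_contentTheory hc⟩, by
    change c (content (xw * yw)) (content (yw * xw))
    rw [content_mul, content_mul, add_comm]
    exact c.refl _⟩

theorem theoryCon_varietyOfCon {c : AddCon CWord} (hc : IsFullyInvariant c) :
    theoryCon (varietyOfCon c hc) = c := by
  refine le_antisymm (le_of_content (theoryCon_isFullyInvariant _).le_zeroCon fun u v h => ?_)
    (le_of_content hc.le_zeroCon fun u v h => ?_)
  · exact theoryCon_content.1 h
  · exact theoryCon_content.2 h

theorem theoryCon_inf (V W : ComVariety) : theoryCon (V ⊓ W) = theoryCon V ⊔ theoryCon W := by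
  refine le_antisymm ?_ (sup_le (theoryCon_le_theoryCon.2 inf_le_left)
    (theoryCon_le_theoryCon.2 inf_le_right))
  have hFI := (theoryCon_isFullyInvariant V).sup (theoryCon_isFullyInvariant W)
  rw [← theoryCon_varietyOfCon hFI, theoryCon_le_theoryCon]
  refine le_inf ?_ ?_ <;> rw [← theoryCon_le_theoryCon, theoryCon_varietyOfCon]
  · exact le_sup_left
  · exact le_sup_right

theorem isUpperModular_iff {V : ComVariety} :
    IsUpperModular V ↔ IsLowerModularCon (theoryCon V) := by
  constructor
  · intro h β γ hβ hγ hle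
    have hb : varietyOfCon β hβ ≤ V := by
      rwa [← theoryCon_le_theoryCon, theoryCon_varietyOfCon]
    have := congrArg theoryCon (h _ (varietyOfCon γ hγ) hb)
    simp only [theoryCon_inf, theoryCon_sup, theoryCon_varietyOfCon] at this
    exact this.ge
  · intro h b c hb
    refine le_antisymm ?_
      (sup_le (le_inf hb le_sup_left) (inf_le_inf_left _ le_sup_right))
    rw [← theoryCon_le_theoryCon]
    simp only [theoryCon_inf, theoryCon_sup]
    exact h _ _ (theoryCon_isFullyInvariant b) (theoryCon_isFullyInvariant c)
      (theoryCon_le_theoryCon.2 hb)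

/-- If a commutative semigroup variety `V ≠ COM` is an
upper-modular element of **Com**, then every subvariety of `V` is an
upper-modular element of **Com**. -/
theorem upperModular_hereditary (V : ComVariety) (hV : V ≠ COMcom)
    (h : IsUpperModular V) :
    ∀ W : ComVariety, W ≤ V → IsUpperModular W := by
  intro W hWV
  rw [isUpperModular_iff] at h ⊢
  refine h.of_le (theoryCon_isFullyInvariant V) ?_ (theoryCon_isFullyInvariant W)
    (theoryCon_le_theoryCon.2 hWV)
  by_contra! hno
  refine hV (le_antisymm ?_ fun e he => ?_)
  · exact (eqTh_mono (Set.singleton_subset_iff.2 V.2)).trans V.1.closed.le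
  · exact mem_th_of_content_eq COMcom
      (hno _ _ (theoryCon_content.2 (show (e.1, e.2) ∈ V.1.th from he)))
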